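/- arXiv:1504.05416 — 6 statements merged into one kernel-verified Lean document; each statement's English description precedes it below -/
import Mathlib

section
/- Let H₀ and H be real Hilbert spaces, ι : H → H₀ a continuous linear map, K : H₀ → H₀ a compact linear operator, and a : H × H → ℝ a continuous bilinear form for which there exists a constant C₀ > 0 with a(f,f) ≥ C₀‖f‖²_H for all f ∈ H. Define ℓ(f,g) := ⟨K(ι f), ι g⟩_{H₀} − a(f,g) for f,g ∈ H, and let N := {f ∈ H : ℓ(f,g) = 0 for all g ∈ H}. Assume that ℓ(f,f) ≤ 0 for every f ∈ H, and that ℓ(f,f) = 0 holds if and only if f ∈ N. Then there exists a constant C₁ > 0 such that −ℓ(f,f) ≥ C₁‖f‖²_H for every f in the orthogonal complement N^⊥ of N in H. -/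
open scoped RealInnerProductSpace

/-- A bounded sequence in a Hilbert space converges weakly along an ultrafilter. -/
theorem exists_weak_limit {H : Type*} [NormedAddCommGroup H] [InnerProductSpace ℝ H]
    [CompleteSpace H] (U : Ultrafilter ℕ) (u : ℕ → H) (R : ℝ) (hu : ∀ n, ‖u n‖ ≤ R) :
    ∃ f : H, ∀ φ : H →L[ℝ] ℝ, Filter.Tendsto (fun n => φ (u n)) U (nhds (φ f)) := by
  let w : ℕ → WeakDual ℝ H := fun n => StrongDual.toWeakDual (InnerProductSpace.toDual ℝ H (u n))
  have hc := WeakDual.isCompact_closedBall (𝕜 := ℝ) (E := H) 0 R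
  obtain ⟨ψ, -, hψ⟩ := hc.ultrafilter_le_nhds (U.map w) (by
    rw [Filter.le_principal_iff]
    refine Filter.mem_map.2 (Filter.Eventually.of_forall fun n => ?_)
    simpa [w] using hu n)
  refine ⟨(InnerProductSpace.toDual ℝ H).symm (WeakDual.toStrongDual ψ), fun φ => ?_⟩
  have h1 : Filter.Tendsto w U (nhds ψ) := hψ
  have h2 := ((WeakDual.eval_continuous (𝕜 := ℝ) (E := H)
    ((InnerProductSpace.toDual ℝ H).symm φ)).tendsto ψ).comp h1
  have e : ∀ x : H, φ x = ⟪x, (InnerProductSpace.toDual ℝ H).symm φ⟫ := fun x => by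
    rw [real_inner_comm, InnerProductSpace.toDual_symm_apply]
  simp only [e]
  rw [InnerProductSpace.toDual_symm_apply]
  exact h2

/-- Abstract spectral-gap lemma: if `ℓ(f,g) = ⟪K(ι f), ι g⟫ - a(f,g)` with `K` compact,
`a` coercive, `ℓ` nonpositive on the diagonal and vanishing exactly on `N`,
then `-ℓ` is coercive on the orthogonal complement of `N`. -/
theorem stmt0 {H₀ H : Type*}
    [NormedAddCommGroup H₀] [InnerProductSpace ℝ H₀] [CompleteSpace H₀]
    [NormedAddCommGroup H] [InnerProductSpace ℝ H] [CompleteSpace H]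
    (ι : H →L[ℝ] H₀) (K : H₀ →L[ℝ] H₀) (hK : IsCompactOperator K)
    (a : H →L[ℝ] H →L[ℝ] ℝ) (C₀ : ℝ) (hC₀ : 0 < C₀)
    (ha : ∀ f : H, C₀ * ‖f‖ ^ 2 ≤ a f f)
    (ℓ : H → H → ℝ)
    (hℓ : ∀ f g : H, ℓ f g = ⟪K (ι f), ι g⟫ - a f g)
    (N : Submodule ℝ H)
    (hN : ∀ f : H, f ∈ N ↔ ∀ g : H, ℓ f g = 0)
    (hneg : ∀ f : H, ℓ f f ≤ 0)
    (hzero : ∀ f : H, ℓ f f = 0 ↔ f ∈ N) :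
    ∃ C₁ : ℝ, 0 < C₁ ∧ ∀ f ∈ Nᗮ, C₁ * ‖f‖ ^ 2 ≤ -ℓ f f := by
  by_contra hcon
  push Not at hcon
  have key : ∀ n : ℕ, ∃ u ∈ Nᗮ, ‖u‖ = 1 ∧ -ℓ u u < 1 / ((n : ℝ) + 1) := by
    intro n
    obtain ⟨f, hf, hlt⟩ := hcon (1 / ((n : ℝ) + 1)) (by positivity)
    have hf0 : f ≠ 0 := by
      rintro rfl
      simp [hℓ] at hlt
    have hp : 0 < ‖f‖ := norm_pos_iff.2 hf0
    refine ⟨‖f‖⁻¹ • f, Submodule.smul_mem _ _ hf, ?_, ?_⟩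
    · rw [norm_smul, norm_inv, norm_norm, inv_mul_cancel₀ hp.ne']
    · have e : ℓ (‖f‖⁻¹ • f) (‖f‖⁻¹ • f) = ℓ f f / ‖f‖ ^ 2 := by
        simp only [hℓ, map_smul, inner_smul_left, inner_smul_right, smul_eq_mul,
          ContinuousLinearMap.smul_apply]
        simp
        field_simp
      rw [e, ← neg_div, div_lt_iff₀ (by positivity)]
      exact hlt
  choose u huN hu1 hul using key
  let U : Ultrafilter ℕ := Filter.hyperfilter ℕ
  have hU : (U : Filter ℕ) ≤ Filter.atTop := by
    rw [← Nat.cofinite_eq_atTop]; exact Filter.hyperfilter_le_cofinite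
  obtain ⟨f, hf⟩ := exists_weak_limit U u 1 (fun n => (hu1 n).le)
  have hℓ0 : Filter.Tendsto (fun n => ℓ (u n) (u n)) U (nhds 0) := by
    have h1 : Filter.Tendsto (fun n : ℕ => -(1 / ((n : ℝ) + 1))) U (nhds 0) := by
      simpa using (tendsto_one_div_add_atTop_nhds_zero_nat (𝕜 := ℝ)).neg.mono_left hU
    exact tendsto_of_tendsto_of_tendsto_of_le_of_le h1 tendsto_const_nhds
      (fun n => by have := hul n; simp only; linarith) (fun n => hneg _)
  -- strong convergence of the compact part
  have hKs : Filter.Tendsto (fun n => K (ι (u n))) U (nhds (K (ι f))) := by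
    have hc : IsCompactOperator (K ∘L ι) := hK.comp_clm ι
    obtain ⟨S, hS, hsub⟩ := hc.image_closedBall_subset_compact (f := ((K ∘L ι : H →L[ℝ] H₀) : H →ₗ[ℝ] H₀)) 1
    obtain ⟨y, -, hy⟩ := hS.ultrafilter_le_nhds (U.map fun n => K (ι (u n))) (by
      rw [Filter.le_principal_iff]
      refine Filter.mem_map.2 (Filter.Eventually.of_forall fun n => ?_)
      exact hsub ⟨u n, by simp [hu1 n], rfl⟩)
    have hy' : Filter.Tendsto (fun n => K (ι (u n))) U (nhds y) := hy
    have : y = K (ι f) := by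
      refine ext_inner_left ℝ fun v => ?_
      refine tendsto_nhds_unique (tendsto_const_nhds.inner hy') ?_
      exact hf ((innerSL ℝ v) ∘L K ∘L ι)
    rwa [this] at hy'
  have hKK : Filter.Tendsto (fun n => ⟪K (ι (u n)), ι (u n)⟫) U (nhds ⟪K (ι f), ι f⟫) := by
    have h1 : Filter.Tendsto (fun n => ⟪K (ι (u n)) - K (ι f), ι (u n)⟫) U (nhds 0) := by
      have h2 : Filter.Tendsto (fun n => ‖K (ι (u n)) - K (ι f)‖ * ‖ι‖) U (nhds 0) := by
        simpa using ((hKs.sub_const (K (ι f))).norm).mul_const ‖ι‖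
      refine squeeze_zero_norm (fun n => ?_) h2
      refine (norm_inner_le_norm _ _).trans ?_
      gcongr
      simpa [hu1 n] using ι.le_opNorm (u n)
    have h3 := hf ((innerSL ℝ (K (ι f))) ∘L ι)
    simpa [inner_sub_left] using h1.add h3
  have ha1 := hf (a f)
  have ha2 := hf (a.flip f)
  have haa : Filter.Tendsto (fun n => a (u n - f) (u n - f)) U (nhds (ℓ f f)) := by
    have := (((hKK.sub hℓ0).sub ha1).sub ha2).add_const (a f f)
    convert this using 2
    · simp [hℓ]; try ring
    · simp [hℓ]; try ring
  have hlim : Filter.Tendsto u U (nhds f) := by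
    rw [tendsto_iff_norm_sub_tendsto_zero]
    have hl : ℓ f f = 0 := le_antisymm (hneg f) (ge_of_tendsto' haa fun n =>
      (by positivity : 0 ≤ C₀ * ‖u n - f‖ ^ 2).trans (ha _))
    rw [hl] at haa
    have h2 : Filter.Tendsto (fun n => C₀ * ‖u n - f‖ ^ 2) U (nhds 0) :=
      squeeze_zero (fun n => by positivity) (fun n => ha _) haa
    have h3 := (h2.const_mul C₀⁻¹).sqrt
    simpa [← mul_assoc, inv_mul_cancel₀ hC₀.ne'] using h3
  have hl : ℓ f f = 0 := le_antisymm (hneg f) (ge_of_tendsto' haa fun n =>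
      (by positivity : 0 ≤ C₀ * ‖u n - f‖ ^ 2).trans (ha _))
  have hfN : f ∈ N := (hzero f).1 hl
  have hfO : f ∈ Nᗮ := N.isClosed_orthogonal.mem_of_tendsto hlim
    (Filter.Eventually.of_forall huN)
  have hf0 : f = 0 := inner_self_eq_zero.1 (hfO f hfN)
  have h1 : ‖f‖ = 1 := by
    refine tendsto_nhds_unique hlim.norm ?_
    simp [hu1]
  simp [hf0] at h1
end

section
/- Let α₁, α₂, e₁, e₂ ∈ ℝ and u₁, u₂ ∈ ℝ³, and define h₁(w) = α₁ + u₁·w + e₁|w|² and h₂(w) = α₂ + u₂·w + e₂|w|² for w ∈ ℝ³. If h₁(v′) + h₂(v′*) − h₁(v) − h₂(v*) = 0 for all v, v* ∈ ℝ³ and all unit vectors σ ∈ ℝ³, then u₁ = u₂ and e₁ = e₂. -/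
open scoped RealInnerProductSpace

/-- Collisional rigidity: if `h₁(v') + h₂(v'*) - h₁(v) - h₂(v*) = 0` for all
velocities and all unit vectors `σ`, where `hᵢ(w) = αᵢ + uᵢ·w + eᵢ|w|²`, then
`u₁ = u₂` and `e₁ = e₂`. -/
theorem stmt2 (α₁ α₂ e₁ e₂ : ℝ) (u₁ u₂ : EuclideanSpace ℝ (Fin 3))
    (h₁ h₂ : EuclideanSpace ℝ (Fin 3) → ℝ)
    (hh₁ : ∀ w : EuclideanSpace ℝ (Fin 3), h₁ w = α₁ + ⟪u₁, w⟫ + e₁ * ‖w‖ ^ 2)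
    (hh₂ : ∀ w : EuclideanSpace ℝ (Fin 3), h₂ w = α₂ + ⟪u₂, w⟫ + e₂ * ‖w‖ ^ 2)
    (hcoll : ∀ v vs σ : EuclideanSpace ℝ (Fin 3), ‖σ‖ = 1 →
      h₁ ((2 : ℝ)⁻¹ • (v + vs) + (‖v - vs‖ / 2) • σ)
        + h₂ ((2 : ℝ)⁻¹ • (v + vs) - (‖v - vs‖ / 2) • σ)
        - h₁ v - h₂ vs = 0) :
    u₁ = u₂ ∧ e₁ = e₂ := by
  have key : ∀ v : EuclideanSpace ℝ (Fin 3), v ≠ 0 →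
      ⟪u₁, v⟫ - ⟪u₂, v⟫ + (e₁ - e₂) * ‖v‖ ^ 2 = 0 := by
    intro v hv
    have hn : ‖v‖ ≠ 0 := norm_ne_zero_iff.mpr hv
    have h := hcoll v 0 (-(‖v‖⁻¹ • v)) (by
      rw [norm_neg, norm_smul, norm_inv, norm_norm, inv_mul_cancel₀ hn])
    have hs : (‖v - 0‖ / 2) • (-(‖v‖⁻¹ • v)) = -((2 : ℝ)⁻¹ • v) := by
      rw [sub_zero, smul_neg, smul_smul]
      congr 2
      field_simp
    have hd : (2 : ℝ)⁻¹ • v + (2 : ℝ)⁻¹ • v = v := by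
      rw [← add_smul]; norm_num
    rw [hs, add_zero, add_neg_cancel, sub_neg_eq_add, hd] at h
    simp only [hh₁, hh₂, inner_zero_right, norm_zero] at h
    linarith
  have he : e₁ = e₂ := by
    obtain ⟨v, hv⟩ := exists_ne (0 : EuclideanSpace ℝ (Fin 3))
    have a := key v hv
    have b := key (-v) (neg_ne_zero.mpr hv)
    rw [inner_neg_right, inner_neg_right, norm_neg] at b
    have hn : ‖v‖ ^ 2 ≠ 0 := pow_ne_zero 2 (norm_ne_zero_iff.mpr hv)
    have c : (e₁ - e₂) * ‖v‖ ^ 2 = 0 := by linarith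
    exact sub_eq_zero.mp ((mul_eq_zero.mp c).resolve_right hn)
  refine ⟨?_, he⟩
  by_contra hu
  have hv : u₁ - u₂ ≠ 0 := sub_ne_zero.mpr hu
  have a := key _ hv
  rw [← inner_sub_left, he, sub_self, zero_mul, add_zero] at a
  exact hv (inner_self_eq_zero.mp a)
end

section
/- For every γ ∈ [0,1] and every v ∈ ℝ³, ∫_{ℝ³} |v−w|^γ e^{−|w|²/2} dw ≥ 2^{γ−1} ∫_{ℝ³} |w|^γ e^{−|w|²/2} dw. Consequently, (2π)^{−3/2} ∫_{ℝ³} |v−w|^γ e^{−|w|²/2} dw ≥ 2^{3γ/2} π^{−1/2} Γ((γ+3)/2) for all v ∈ ℝ³, where Γ is the Gamma function. -/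
open MeasureTheory

lemma aux_int (γ : ℝ) (hγ0 : 0 ≤ γ) :
    Integrable (fun w : EuclideanSpace ℝ (Fin 3) => ‖w‖ ^ γ * Real.exp (-‖w‖ ^ 2 / 2)) := by
  have h := integrable_fun_norm_addHaar (volume : Measure (EuclideanSpace ℝ (Fin 3)))
    (f := fun r : ℝ => r ^ γ * Real.exp (-r ^ 2 / 2))
  refine h.2 ?_
  have h2 := integrableOn_rpow_mul_exp_neg_mul_sq (b := 1/2) (by norm_num)
    (s := γ + 2) (by linarith)
  refine h2.congr_fun (fun x hx => ?_) measurableSet_Ioi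
  have hx : 0 < x := hx
  simp only [finrank_euclideanSpace, Fintype.card_fin, smul_eq_mul]
  rw [Real.rpow_add hx, show (2:ℝ) = ((2:ℕ):ℝ) by norm_num, Real.rpow_natCast]
  norm_num
  rw [show -x ^ 2 / 2 = -(1/2 * x^2) by ring]
  ring_nf

lemma aux_val (γ : ℝ) (hγ0 : 0 ≤ γ) :
    ∫ w : EuclideanSpace ℝ (Fin 3), ‖w‖ ^ γ * Real.exp (-‖w‖ ^ 2 / 2)
      = 4 * Real.pi * ((1/2 : ℝ) ^ (-(γ + 2 + 1) / 2) * (1/2) * Real.Gamma ((γ + 2 + 1) / 2)) := by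
  have h := integral_fun_norm_addHaar (volume : Measure (EuclideanSpace ℝ (Fin 3)))
    (fun r : ℝ => r ^ γ * Real.exp (-r ^ 2 / 2))
  rw [h, ← integral_rpow_mul_exp_neg_mul_rpow (p := 2) (q := γ + 2) (b := 1/2) (by norm_num)
    (by linarith) (by norm_num)]
  have e : ∫ y in Set.Ioi (0:ℝ), y ^ (Module.finrank ℝ (EuclideanSpace ℝ (Fin 3)) - 1) •
      (y ^ γ * Real.exp (-y ^ 2 / 2)) =
      ∫ x in Set.Ioi (0 : ℝ), x ^ (γ + 2) * Real.exp (-(1/2) * x ^ (2:ℝ)) := by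
    refine setIntegral_congr_fun measurableSet_Ioi (fun x hx => ?_)
    have hx : 0 < x := hx
    simp only [finrank_euclideanSpace, Fintype.card_fin, smul_eq_mul]
    rw [Real.rpow_add hx, Real.rpow_two]
    norm_num
    rw [show -x ^ 2 / 2 = -(1/2 * x^2) by ring]
    ring_nf
  rw [e]
  have hv : (volume : Measure (EuclideanSpace ℝ (Fin 3))).real (Metric.ball 0 1)
      = Real.pi * 4 / 3 := by
    rw [measureReal_def, EuclideanSpace.volume_ball_fin_three]
    simp [Real.pi_pos.le]
    try positivity
  rw [hv]
  simp only [finrank_euclideanSpace, Fintype.card_fin, smul_eq_mul, nsmul_eq_mul]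
  push_cast
  ring

lemma aux_int2 (γ : ℝ) (hγ0 : 0 ≤ γ) (hγ1 : γ ≤ 1) (v : EuclideanSpace ℝ (Fin 3)) :
    Integrable (fun w : EuclideanSpace ℝ (Fin 3) => ‖v - w‖ ^ γ * Real.exp (-‖w‖ ^ 2 / 2)) := by
  have h0 := aux_int 0 le_rfl
  simp only [Real.rpow_zero, one_mul] at h0
  refine ((h0.const_mul (‖v‖ ^ γ)).add (aux_int γ hγ0)).mono' ?_ (ae_of_all _ fun w => ?_)
  · refine Continuous.aestronglyMeasurable ?_
    refine Continuous.mul ?_ (by fun_prop)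
    exact Continuous.rpow_const (by fun_prop) (fun _ => Or.inr hγ0)
  · rw [Real.norm_of_nonneg (by positivity)]
    simp only [Pi.add_apply]
    rw [← add_mul]
    gcongr
    exact (Real.rpow_le_rpow (norm_nonneg _) (norm_sub_le v w) hγ0).trans
      (Real.rpow_add_le_add_rpow (norm_nonneg _) (norm_nonneg _) hγ0 hγ1)

lemma aux_main (γ : ℝ) (hγ0 : 0 ≤ γ) (hγ1 : γ ≤ 1) (v : EuclideanSpace ℝ (Fin 3)) :
    (2 : ℝ) ^ (γ - 1) *
        ∫ w : EuclideanSpace ℝ (Fin 3), ‖w‖ ^ γ * Real.exp (-‖w‖ ^ 2 / 2)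
      ≤ ∫ w : EuclideanSpace ℝ (Fin 3), ‖v - w‖ ^ γ * Real.exp (-‖w‖ ^ 2 / 2) := by
  have i1 := aux_int2 γ hγ0 hγ1 v
  have i2 := i1.comp_neg
  have e := integral_neg_eq_self
    (fun w : EuclideanSpace ℝ (Fin 3) => ‖v - w‖ ^ γ * Real.exp (-‖w‖ ^ 2 / 2)) volume
  have key : ∫ w : EuclideanSpace ℝ (Fin 3),
      (2:ℝ) ^ γ * (‖w‖ ^ γ * Real.exp (-‖w‖ ^ 2 / 2)) ≤
      ∫ w : EuclideanSpace ℝ (Fin 3), (‖v - w‖ ^ γ * Real.exp (-‖w‖ ^ 2 / 2)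
        + ‖v - -w‖ ^ γ * Real.exp (-‖-w‖ ^ 2 / 2)) := by
    refine integral_mono ((aux_int γ hγ0).const_mul _) (i1.add i2) (fun w => ?_)
    simp only [norm_neg]
    rw [← add_mul, ← mul_assoc, ← Real.mul_rpow (by norm_num) (norm_nonneg _)]
    gcongr
    refine le_trans (Real.rpow_le_rpow (by positivity) ?_ hγ0)
      (Real.rpow_add_le_add_rpow (norm_nonneg _) (norm_nonneg _) hγ0 hγ1)
    calc 2 * ‖w‖ = ‖(v - w) - (v - -w)‖ := by
          rw [show (v - w) - (v - -w) = (-2 : ℝ) • w by module, norm_smul]; norm_num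
      _ ≤ _ := norm_sub_le _ _
  rw [integral_const_mul, integral_add i1 i2, e] at key
  rw [Real.rpow_sub_one (by norm_num)]
  linarith

/-- Uniform lower bound `G(v) ≥ 2^(γ-1) G(0)` for the Gaussian moment
`G(v) = ∫_{ℝ³} |v-w|^γ e^{-|w|²/2} dw`, and the resulting explicit lower bound. -/
theorem stmt4 (γ : ℝ) (hγ0 : 0 ≤ γ) (hγ1 : γ ≤ 1) (v : EuclideanSpace ℝ (Fin 3)) :
    (2 : ℝ) ^ (γ - 1) *
        ∫ w : EuclideanSpace ℝ (Fin 3), ‖w‖ ^ γ * Real.exp (-‖w‖ ^ 2 / 2)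
      ≤ ∫ w : EuclideanSpace ℝ (Fin 3), ‖v - w‖ ^ γ * Real.exp (-‖w‖ ^ 2 / 2)
    ∧ (2 : ℝ) ^ (3 * γ / 2) * Real.pi ^ (-(1 : ℝ) / 2) * Real.Gamma ((γ + 3) / 2)
      ≤ (2 * Real.pi) ^ (-(3 : ℝ) / 2) *
        ∫ w : EuclideanSpace ℝ (Fin 3), ‖v - w‖ ^ γ * Real.exp (-‖w‖ ^ 2 / 2) := by
  have h := aux_main γ hγ0 hγ1 v
  refine ⟨h, ?_⟩
  refine le_trans (le_of_eq ?_) (mul_le_mul_of_nonneg_left h (by positivity))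
  rw [aux_val γ hγ0, show γ + 2 + 1 = γ + 3 by ring, Real.mul_rpow (by norm_num) Real.pi_pos.le,
    one_div, Real.inv_rpow (by norm_num), ← Real.rpow_neg (by norm_num)]
  have e1 : (2:ℝ) ^ (3 * γ / 2) = 2 ^ (-(3:ℝ)/2) * 2 ^ (γ - 1) * 2 ^ (-(-(γ + 3) / 2)) * 2 := by
    rw [← Real.rpow_add (by norm_num), ← Real.rpow_add (by norm_num),
      ← Real.rpow_add_one (by norm_num)]
    congr 1; ring
  have e2 : Real.pi ^ (-(1:ℝ)/2) = Real.pi ^ (-(3:ℝ)/2) * Real.pi := by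
    rw [← Real.rpow_add_one Real.pi_ne_zero]; congr 1; norm_num
  rw [e1, e2]
  ring
end

section
/- Let n ≥ 1, γ ∈ [0,1], and let C₁ > 0, ℓᵇ > 0 and ρ_{∞,1}, …, ρ_{∞,n} > 0 with ρ_∞ = Σ_{j=1}^n ρ_{∞,j}. For 1 ≤ i,j ≤ n let Φ_{ij} : (0,∞) → [0,∞) be measurable with Φ_{ij}(r) ≥ C₁ r^γ for all r > 0, and let b_{ij} : [−1,1] → [0,∞) be measurable such that for every unit vector e ∈ ℝ³, ∫_{S²} b_{ij}(σ·e) dσ ≥ 2π ℓᵇ (integration with respect to the surface measure on the unit sphere S² ⊂ ℝ³). Define the collision frequencies ν_i(v) = Σ_{j=1}^n ∫_{ℝ³} ∫_{S²} Φ_{ij}(|v−v*|) b_{ij}(σ·(v−v*)/|v−v*|) M_j(v*) dσ dv*. Then for every i and every v ∈ ℝ³, ν_i(v) ≥ 2^{3γ/2} C₁ ℓᵇ ρ_∞ Γ((γ+3)/2) / √π. -/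
open MeasureTheory
open scoped ENNReal RealInnerProductSpace


lemma aux_moment (γ : ℝ) (hγ0 : 0 ≤ γ) :
    ∫ x : EuclideanSpace ℝ (Fin 3), ‖x‖ ^ γ * Real.exp (-‖x‖ ^ 2 / 2) =
      4 * Real.pi * ((2 : ℝ) ^ ((γ + 3) / 2) * (1 / 2) * Real.Gamma ((γ + 3) / 2)) := by
  rw [integral_fun_norm_addHaar (volume : Measure (EuclideanSpace ℝ (Fin 3)))
    (fun r => r ^ γ * Real.exp (-r ^ 2 / 2))]
  have h1 : ∫ y in Set.Ioi (0 : ℝ), y ^ (Module.finrank ℝ (EuclideanSpace ℝ (Fin 3)) - 1) •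
      (y ^ γ * Real.exp (-y ^ 2 / 2)) =
      (2 : ℝ) ^ ((γ + 3) / 2) * (1 / 2) * Real.Gamma ((γ + 3) / 2) := by
    have h := integral_rpow_mul_exp_neg_mul_rpow (p := 2) (q := γ + 2) (b := 1 / 2)
      (by norm_num) (by linarith) (by norm_num)
    have e : (1 / 2 : ℝ) ^ (-(γ + 2 + 1) / 2) = (2 : ℝ) ^ ((γ + 3) / 2) := by
      rw [one_div, Real.inv_rpow (by norm_num), ← Real.rpow_neg (by norm_num)]
      congr 1; ring
    rw [e, show (γ + 2 + 1) / 2 = (γ + 3) / 2 by ring] at h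
    rw [← h]
    apply setIntegral_congr_fun measurableSet_Ioi
    intro y hy
    have hy' : (0 : ℝ) < y := hy
    simp only [finrank_euclideanSpace, Fintype.card_fin, smul_eq_mul]
    rw [Real.rpow_add hy', Real.rpow_two]
    ring_nf
  rw [h1]
  have h2 : (volume : Measure (EuclideanSpace ℝ (Fin 3))).real (Metric.ball 0 1)
      = Real.pi * 4 / 3 := by
    rw [Measure.real, EuclideanSpace.volume_ball_fin_three]
    simp
    positivity
  rw [h2]
  simp only [finrank_euclideanSpace, Fintype.card_fin, smul_eq_mul, nsmul_eq_mul]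
  push_cast
  ring

lemma aux_J (γ : ℝ) (hγ0 : 0 ≤ γ) (hγ1 : γ ≤ 1) (v : EuclideanSpace ℝ (Fin 3)) :
    ENNReal.ofReal ((2 : ℝ) ^ γ / 2 *
      (4 * Real.pi * ((2 : ℝ) ^ ((γ + 3) / 2) * (1 / 2) * Real.Gamma ((γ + 3) / 2)))) ≤
    ∫⁻ x : EuclideanSpace ℝ (Fin 3),
      ENNReal.ofReal (‖v - x‖ ^ γ * Real.exp (-‖x‖ ^ 2 / 2)) := by
  set I := 4 * Real.pi * ((2 : ℝ) ^ ((γ + 3) / 2) * (1 / 2) * Real.Gamma ((γ + 3) / 2)) with hI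
  have hG : 0 < Real.Gamma ((γ + 3) / 2) := Real.Gamma_pos_of_pos (by linarith)
  have hIpos : 0 < I := by positivity
  have hint : Integrable (fun x : EuclideanSpace ℝ (Fin 3) =>
      ‖x‖ ^ γ * Real.exp (-‖x‖ ^ 2 / 2)) := by
    apply Integrable.of_integral_ne_zero
    rw [aux_moment γ hγ0]
    exact hIpos.ne'
  set J := ∫⁻ x : EuclideanSpace ℝ (Fin 3),
      ENNReal.ofReal (‖v - x‖ ^ γ * Real.exp (-‖x‖ ^ 2 / 2)) with hJ
  have hJ' : J = ∫⁻ x : EuclideanSpace ℝ (Fin 3),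
      ENNReal.ofReal (‖v + x‖ ^ γ * Real.exp (-‖x‖ ^ 2 / 2)) := by
    rw [hJ, ← lintegral_neg_eq_self]
    simp
  have hL : ENNReal.ofReal ((2 : ℝ) ^ γ * I) = ∫⁻ x : EuclideanSpace ℝ (Fin 3),
      ENNReal.ofReal ((2 : ℝ) ^ γ * (‖x‖ ^ γ * Real.exp (-‖x‖ ^ 2 / 2))) := by
    rw [← ofReal_integral_eq_lintegral_ofReal (hint.const_mul _)
      (Filter.Eventually.of_forall fun x => by positivity), integral_const_mul,
      aux_moment γ hγ0]
  have key : ENNReal.ofReal ((2 : ℝ) ^ γ * I) ≤ J + J := by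
    nth_rewrite 2 [hJ']
    rw [hL, hJ, ← lintegral_add_left (by fun_prop)]
    apply lintegral_mono
    intro x
    simp only
    rw [← ENNReal.ofReal_add (by positivity) (by positivity)]
    apply ENNReal.ofReal_le_ofReal
    rw [← add_mul, ← mul_assoc]
    apply mul_le_mul_of_nonneg_right _ (Real.exp_nonneg _)
    rw [← Real.mul_rpow (by norm_num) (norm_nonneg _)]
    have h1 : 2 * ‖x‖ ≤ ‖v - x‖ + ‖v + x‖ := by
      have := norm_sub_le (v + x) (v - x)
      have e : v + x - (v - x) = (2 : ℝ) • x := by rw [two_smul]; abel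
      rw [e, norm_smul] at this
      simp at this
      linarith
    calc (2 * ‖x‖) ^ γ ≤ (‖v - x‖ + ‖v + x‖) ^ γ :=
          Real.rpow_le_rpow (by positivity) h1 hγ0
      _ ≤ _ := Real.rpow_add_le_add_rpow (norm_nonneg _) (norm_nonneg _) hγ0 hγ1
  rw [← two_mul] at key
  have e : (2 : ℝ) ^ γ / 2 * I = (2 : ℝ) ^ γ * I / 2 := by ring
  rw [e, ENNReal.ofReal_div_of_pos (by norm_num)]
  apply ENNReal.div_le_of_le_mul
  rw [mul_comm _ (ENNReal.ofReal 2)]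
  simpa using key

/-- Explicit uniform lower bound for the multi-species collision frequencies:
under assumptions (A2)-(A4) of the paper,
`ν_i(v) ≥ 2^(3γ/2) C₁ ℓᵇ ρ_∞ Γ((γ+3)/2) / √π` for all `i` and `v`. -/
theorem stmt5 (n : ℕ) (hn : 1 ≤ n) (γ C₁ ℓb : ℝ)
    (hγ0 : 0 ≤ γ) (hγ1 : γ ≤ 1) (hC₁ : 0 < C₁) (hℓb : 0 < ℓb)
    (ρ : Fin n → ℝ) (hρ : ∀ j, 0 < ρ j)
    (Φ : Fin n → Fin n → ℝ → ℝ)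
    (hΦmeas : ∀ i j, Measurable (Φ i j))
    (hΦnonneg : ∀ i j r, 0 < r → 0 ≤ Φ i j r)
    (hΦlow : ∀ i j r, 0 < r → C₁ * r ^ γ ≤ Φ i j r)
    (b : Fin n → Fin n → ℝ → ℝ)
    (hbmeas : ∀ i j, Measurable (b i j))
    (hbnonneg : ∀ i j s, 0 ≤ b i j s)
    (hbavg : ∀ i j, ∀ e : EuclideanSpace ℝ (Fin 3), ‖e‖ = 1 →
      ENNReal.ofReal (2 * Real.pi * ℓb) ≤
        ∫⁻ σ : Metric.sphere (0 : EuclideanSpace ℝ (Fin 3)) 1,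
          ENNReal.ofReal (b i j ⟪(σ : EuclideanSpace ℝ (Fin 3)), e⟫)
          ∂(volume : Measure (EuclideanSpace ℝ (Fin 3))).toSphere)
    (M : Fin n → EuclideanSpace ℝ (Fin 3) → ℝ)
    (hM : ∀ j v, M j v = ρ j * (2 * Real.pi) ^ (-(3 : ℝ) / 2) * Real.exp (-‖v‖ ^ 2 / 2))
    (ν : Fin n → EuclideanSpace ℝ (Fin 3) → ℝ≥0∞)
    (hν : ∀ i v, ν i v = ∑ j, ∫⁻ vs : EuclideanSpace ℝ (Fin 3),
      (∫⁻ σ : Metric.sphere (0 : EuclideanSpace ℝ (Fin 3)) 1,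
        ENNReal.ofReal (Φ i j ‖v - vs‖ *
          b i j (⟪(σ : EuclideanSpace ℝ (Fin 3)), v - vs⟫ / ‖v - vs‖) * M j vs)
        ∂(volume : Measure (EuclideanSpace ℝ (Fin 3))).toSphere)) :
    ∀ i, ∀ v : EuclideanSpace ℝ (Fin 3),
      ENNReal.ofReal ((2 : ℝ) ^ (3 * γ / 2) * C₁ * ℓb * (∑ j, ρ j) *
        Real.Gamma ((γ + 3) / 2) / Real.sqrt Real.pi) ≤ ν i v := by
  intro i v
  rw [hν]
  have hG : 0 < Real.Gamma ((γ + 3) / 2) := Real.Gamma_pos_of_pos (by linarith)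
  have hpi := Real.pi_pos
  have hterm : ∀ j, ENNReal.ofReal ((2 : ℝ) ^ (3 * γ / 2) * C₁ * ℓb * ρ j *
        Real.Gamma ((γ + 3) / 2) / Real.sqrt Real.pi) ≤
      ∫⁻ vs : EuclideanSpace ℝ (Fin 3),
      (∫⁻ σ : Metric.sphere (0 : EuclideanSpace ℝ (Fin 3)) 1,
        ENNReal.ofReal (Φ i j ‖v - vs‖ *
          b i j (⟪(σ : EuclideanSpace ℝ (Fin 3)), v - vs⟫ / ‖v - vs‖) * M j vs)
        ∂(volume : Measure (EuclideanSpace ℝ (Fin 3))).toSphere) := by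
    intro j
    have hρj := hρ j
    set K : ℝ := C₁ * (ρ j * (2 * Real.pi) ^ (-(3 : ℝ) / 2)) * (2 * Real.pi * ℓb) with hK
    have hK0 : 0 < K := by positivity
    calc _ ≤ ENNReal.ofReal (K * ((2 : ℝ) ^ γ / 2 *
      (4 * Real.pi * ((2 : ℝ) ^ ((γ + 3) / 2) * (1 / 2) * Real.Gamma ((γ + 3) / 2))))) := by
          apply ENNReal.ofReal_le_ofReal
          have e1 : (2 : ℝ) ^ γ * (2 : ℝ) ^ ((γ + 3) / 2) =
              (2 : ℝ) ^ (3 * γ / 2) * (2 : ℝ) ^ ((3 : ℝ) / 2) := by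
            rw [← Real.rpow_add (by norm_num), ← Real.rpow_add (by norm_num)]
            congr 1; ring
          have e2 : (2 * Real.pi) ^ (-(3 : ℝ) / 2) * (2 : ℝ) ^ ((3 : ℝ) / 2) * Real.pi
              = 1 / Real.sqrt Real.pi := by
            rw [Real.mul_rpow (by norm_num) hpi.le, Real.sqrt_eq_rpow, one_div,
              ← Real.rpow_neg hpi.le]
            have a1 : (2 : ℝ) ^ (-(3 : ℝ) / 2) * (2 : ℝ) ^ ((3 : ℝ) / 2) = 1 := by
              rw [← Real.rpow_add (by norm_num)]; norm_num
            have a2 : Real.pi ^ (-(3 : ℝ) / 2) * Real.pi = Real.pi ^ (-(1 / 2) : ℝ) := by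
              nth_rewrite 2 [← Real.rpow_one Real.pi]
              rw [← Real.rpow_add hpi]; norm_num
            calc _ = ((2 : ℝ) ^ (-(3 : ℝ) / 2) * (2 : ℝ) ^ ((3 : ℝ) / 2)) *
                  (Real.pi ^ (-(3 : ℝ) / 2) * Real.pi) := by ring
              _ = _ := by rw [a1, a2, one_mul]
          have e3 : K * ((2 : ℝ) ^ γ / 2 * (4 * Real.pi * ((2 : ℝ) ^ ((γ + 3) / 2) * (1 / 2) *
              Real.Gamma ((γ + 3) / 2)))) = (2 * Real.pi) * ((2 : ℝ) ^ (3 * γ / 2) * C₁ * ℓb * ρ j *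
                Real.Gamma ((γ + 3) / 2) / Real.sqrt Real.pi) := by
            calc _ = C₁ * ρ j * ℓb * Real.Gamma ((γ + 3) / 2) * (2 * Real.pi) *
                  ((2 * Real.pi) ^ (-(3 : ℝ) / 2) * Real.pi) *
                  ((2 : ℝ) ^ γ * (2 : ℝ) ^ ((γ + 3) / 2)) := by rw [hK]; ring
              _ = C₁ * ρ j * ℓb * Real.Gamma ((γ + 3) / 2) * (2 * Real.pi) *
                  ((2 * Real.pi) ^ (-(3 : ℝ) / 2) * (2 : ℝ) ^ ((3 : ℝ) / 2) * Real.pi) *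
                  (2 : ℝ) ^ (3 * γ / 2) := by rw [e1]; ring
              _ = _ := by rw [e2]; ring
          rw [e3]
          apply le_mul_of_one_le_left (by positivity)
          linarith [Real.pi_gt_three]
      _ ≤ ENNReal.ofReal K * ∫⁻ x : EuclideanSpace ℝ (Fin 3),
            ENNReal.ofReal (‖v - x‖ ^ γ * Real.exp (-‖x‖ ^ 2 / 2)) := by
          rw [ENNReal.ofReal_mul hK0.le]
          gcongr
          exact aux_J γ hγ0 hγ1 v
      _ = ∫⁻ x : EuclideanSpace ℝ (Fin 3), ENNReal.ofReal K *
            ENNReal.ofReal (‖v - x‖ ^ γ * Real.exp (-‖x‖ ^ 2 / 2)) := by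
          rw [lintegral_const_mul _ (by fun_prop)]
      _ ≤ _ := by
          apply lintegral_mono_ae
          have hae : ∀ᵐ x : EuclideanSpace ℝ (Fin 3), x ≠ v := by
            simp [ae_iff]
          filter_upwards [hae] with x hx
          have hr : 0 < ‖v - x‖ := norm_pos_iff.2 (sub_ne_zero.2 (Ne.symm hx))
          have hMx : 0 ≤ M j x := by rw [hM]; positivity
          have hΦM : 0 ≤ Φ i j ‖v - x‖ * M j x := mul_nonneg (hΦnonneg i j _ hr) hMx
          have hb := hbavg i j (‖v - x‖⁻¹ • (v - x)) (by
            rw [norm_smul, norm_inv, norm_norm, inv_mul_cancel₀ hr.ne'])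
          calc _ = ENNReal.ofReal (C₁ * ‖v - x‖ ^ γ * M j x) *
                  ENNReal.ofReal (2 * Real.pi * ℓb) := by
                rw [← ENNReal.ofReal_mul hK0.le, ← ENNReal.ofReal_mul (by positivity), hM, hK]
                congr 1; ring
            _ ≤ ENNReal.ofReal (Φ i j ‖v - x‖ * M j x) * _ := by
                refine mul_le_mul' (ENNReal.ofReal_le_ofReal ?_) hb
                exact mul_le_mul_of_nonneg_right (hΦlow i j _ hr) hMx
            _ = _ := by
                rw [← lintegral_const_mul' _ _ ENNReal.ofReal_ne_top]
                apply lintegral_congr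
                intro σ
                rw [← ENNReal.ofReal_mul hΦM, inner_smul_right, inv_mul_eq_div]
                congr 1; ring
  calc _ = ENNReal.ofReal (∑ j, (2 : ℝ) ^ (3 * γ / 2) * C₁ * ℓb * ρ j *
        Real.Gamma ((γ + 3) / 2) / Real.sqrt Real.pi) := by
        rw [Finset.mul_sum, Finset.sum_mul, Finset.sum_div]
    _ = ∑ j, ENNReal.ofReal ((2 : ℝ) ^ (3 * γ / 2) * C₁ * ℓb * ρ j *
        Real.Gamma ((γ + 3) / 2) / Real.sqrt Real.pi) := by
        apply ENNReal.ofReal_sum_of_nonneg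
        intro j _
        have := hρ j
        positivity
    _ ≤ _ := Finset.sum_le_sum fun j _ => hterm j
end

section
/- Let B : [0,∞) × [−1,1] → [0,∞) be measurable and set b(v, v*, σ) := B(|v − v*|, σ·(v − v*)/|v − v*|) for v ≠ v* (and b := 0 on the null set v = v*). Let μ denote the product of Lebesgue measure on ℝ³ × ℝ³ with the standard surface measure on the unit sphere S² ⊂ ℝ³, and define v′ = (v+v*)/2 + (|v−v*|/2)σ. Assume the function (v, v*, σ) ↦ b(v,v*,σ) |v′ − v|² e^{−(|v|²+|v*|²)/2} is μ-integrable. Then for every u ∈ ℝ³, ∫ b(v,v*,σ) (u·(v′ − v))² e^{−(|v|²+|v*|²)/2} dμ = (|u|²/3) ∫ b(v,v*,σ) |v − v′|² e^{−(|v|²+|v*|²)/2} dμ. -/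
open MeasureTheory
open scoped RealInnerProductSpace Classical

noncomputable abbrev E3 := EuclideanSpace ℝ (Fin 3)

/-- The action of a linear isometry on the unit sphere. -/
noncomputable def sphEquiv (R : E3 ≃ₗᵢ[ℝ] E3) :
    Metric.sphere (0 : E3) 1 ≃ᵐ Metric.sphere (0 : E3) 1 where
  toFun x := ⟨R x, by simp⟩
  invFun x := ⟨R.symm x, by simp⟩
  left_inv x := by simp
  right_inv x := by simp
  measurable_toFun :=
    (R.continuous.measurable.comp measurable_subtype_coe).subtype_mk
  measurable_invFun :=
    (R.symm.continuous.measurable.comp measurable_subtype_coe).subtype_mk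

lemma sphEquiv_coe (R : E3 ≃ₗᵢ[ℝ] E3) (x : Metric.sphere (0 : E3) 1) :
    ((sphEquiv R x : Metric.sphere (0 : E3) 1) : E3) = R x := rfl

open scoped Pointwise in
lemma sphEquiv_mp (R : E3 ≃ₗᵢ[ℝ] E3) :
    MeasurePreserving (sphEquiv R) (volume : Measure E3).toSphere
      (volume : Measure E3).toSphere := by
  refine ⟨(sphEquiv R).measurable, ?_⟩
  ext s hs
  rw [Measure.map_apply (sphEquiv R).measurable hs, Measure.toSphere_apply' _ hs,
    Measure.toSphere_apply' _ ((sphEquiv R).measurable hs)]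
  congr 1
  have hset : (Set.Ioo (0 : ℝ) 1 • (Subtype.val '' (sphEquiv R ⁻¹' s)) : Set E3)
      = R.toMeasurableEquiv ⁻¹' (Set.Ioo (0 : ℝ) 1 • (Subtype.val '' s)) := by
    ext x
    simp only [Set.mem_smul, Set.mem_preimage, Set.mem_image]
    constructor
    · rintro ⟨r, hr, _, ⟨y, hy, rfl⟩, rfl⟩
      exact ⟨r, hr, _, ⟨_, hy, rfl⟩, by
        rw [sphEquiv_coe]
        exact (R.map_smul r (y : E3)).symm⟩
    · rintro ⟨r, hr, _, ⟨y, hy, rfl⟩, hx⟩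
      refine ⟨r, hr, _, ⟨(sphEquiv R).symm y, ?_, rfl⟩, ?_⟩
      · simpa using hy
      · apply R.injective
        refine Eq.trans ?_ hx
        rw [R.map_smul, ← sphEquiv_coe]
        simp
  rw [hset]
  exact (R.measurePreserving).measure_preimage_equiv (f := R.toMeasurableEquiv) _

theorem stmt10 (B : ℝ → ℝ → ℝ)
    (hBmeas : Measurable fun p : ℝ × ℝ => B p.1 p.2)
    (hBnonneg : ∀ s t : ℝ, 0 ≤ s → t ∈ Set.Icc (-1 : ℝ) 1 → 0 ≤ B s t)
    (b : E3 → E3 → E3 → ℝ)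
    (hb : ∀ v vs σ : E3, b v vs σ =
      if v = vs then 0 else B ‖v - vs‖ (⟪σ, v - vs⟫ / ‖v - vs‖))
    (v' : E3 → E3 → E3 → E3)
    (hv' : ∀ v vs σ : E3, v' v vs σ = (2 : ℝ)⁻¹ • (v + vs) + (‖v - vs‖ / 2) • σ)
    (μ : Measure ((E3 × E3) × Metric.sphere (0 : E3) 1))
    (hμ : μ = ((volume : Measure E3).prod volume).prod (volume : Measure E3).toSphere)
    (hint : Integrable (fun p : (E3 × E3) × Metric.sphere (0 : E3) 1 =>
      b p.1.1 p.1.2 (p.2 : E3) * ‖v' p.1.1 p.1.2 (p.2 : E3) - p.1.1‖ ^ 2 *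
        Real.exp (-(‖p.1.1‖ ^ 2 + ‖p.1.2‖ ^ 2) / 2)) μ)
    (u : E3) :
    (∫ p : (E3 × E3) × Metric.sphere (0 : E3) 1,
        b p.1.1 p.1.2 (p.2 : E3) * ⟪u, v' p.1.1 p.1.2 (p.2 : E3) - p.1.1⟫ ^ 2 *
          Real.exp (-(‖p.1.1‖ ^ 2 + ‖p.1.2‖ ^ 2) / 2) ∂μ)
      = ‖u‖ ^ 2 / 3 *
        ∫ p : (E3 × E3) × Metric.sphere (0 : E3) 1,
          b p.1.1 p.1.2 (p.2 : E3) * ‖p.1.1 - v' p.1.1 p.1.2 (p.2 : E3)‖ ^ 2 *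
            Real.exp (-(‖p.1.1‖ ^ 2 + ‖p.1.2‖ ^ 2) / 2) ∂μ := by
  set w : (E3 × E3) × Metric.sphere (0 : E3) 1 → E3 :=
    fun p => v' p.1.1 p.1.2 (p.2 : E3) - p.1.1 with hw
  set g : (E3 × E3) × Metric.sphere (0 : E3) 1 → ℝ :=
    fun p => b p.1.1 p.1.2 (p.2 : E3) * Real.exp (-(‖p.1.1‖ ^ 2 + ‖p.1.2‖ ^ 2) / 2) with hg
  have hint' : Integrable (fun p => g p * ‖w p‖ ^ 2) μ := by
    refine hint.congr (Filter.Eventually.of_forall fun p => ?_)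
    simp only [hg, hw]; ring
  have hL : ∀ u : E3, (∫ p : (E3 × E3) × Metric.sphere (0 : E3) 1,
        b p.1.1 p.1.2 (p.2 : E3) * ⟪u, v' p.1.1 p.1.2 (p.2 : E3) - p.1.1⟫ ^ 2 *
          Real.exp (-(‖p.1.1‖ ^ 2 + ‖p.1.2‖ ^ 2) / 2) ∂μ)
      = ∫ p, g p * ⟪u, w p⟫ ^ 2 ∂μ := by
    intro u
    refine integral_congr_ae (Filter.Eventually.of_forall fun p => ?_)
    simp only [hg, hw]; ring
  have hR : (∫ p : (E3 × E3) × Metric.sphere (0 : E3) 1,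
          b p.1.1 p.1.2 (p.2 : E3) * ‖p.1.1 - v' p.1.1 p.1.2 (p.2 : E3)‖ ^ 2 *
            Real.exp (-(‖p.1.1‖ ^ 2 + ‖p.1.2‖ ^ 2) / 2) ∂μ)
      = ∫ p, g p * ‖w p‖ ^ 2 ∂μ := by
    refine integral_congr_ae (Filter.Eventually.of_forall fun p => ?_)
    simp only [hg, hw]; rw [norm_sub_rev]; ring
  rw [hL, hR]
  clear hL hR
  have hwm : Measurable w := by
    simp only [hw, hv']
    have : Continuous fun p : (E3 × E3) × Metric.sphere (0 : E3) 1 =>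
      (2 : ℝ)⁻¹ • (p.1.1 + p.1.2) + (‖p.1.1 - p.1.2‖ / 2) • (p.2 : E3) - p.1.1 := by fun_prop
    exact this.measurable
  have hI : ∀ e : E3, Integrable (fun p => g p * ⟪e, w p⟫ ^ 2) μ := by
    intro e
    have hm : Measurable fun p => ⟪e, w p⟫ ^ 2 / ‖w p‖ ^ 2 :=
      ((measurable_const.inner hwm).pow_const 2).div (hwm.norm.pow_const 2)
    have h := hint'.bdd_mul (c := ‖e‖ ^ 2) hm.aestronglyMeasurable
      (Filter.Eventually.of_forall fun p => ?_)
    · refine h.congr (Filter.Eventually.of_forall fun p => ?_)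
      simp only
      by_cases h0 : w p = 0
      · simp [h0]
      · have : ‖w p‖ ≠ 0 := by simpa using h0
        field_simp
    · rw [Real.norm_of_nonneg (by positivity)]
      refine div_le_of_le_mul₀ (by positivity) (by positivity) ?_
      rw [← mul_pow, ← sq_abs ⟪e, w p⟫]
      gcongr
      exact abs_real_inner_le_norm _ _
  have hinv : ∀ (R : E3 ≃ₗᵢ[ℝ] E3) (e : E3),
      ∫ p, g p * ⟪R e, w p⟫ ^ 2 ∂μ = ∫ p, g p * ⟪e, w p⟫ ^ 2 ∂μ := by
    intro R e
    let T : ((E3 × E3) × Metric.sphere (0 : E3) 1) ≃ᵐ ((E3 × E3) × Metric.sphere (0 : E3) 1) :=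
      (R.toMeasurableEquiv.prodCongr R.toMeasurableEquiv).prodCongr (sphEquiv R)
    have hT : MeasurePreserving T μ μ := by
      rw [hμ]
      exact (R.measurePreserving.prod R.measurePreserving).prod (sphEquiv_mp R)
    have hTe : ∀ p, T p = ((R p.1.1, R p.1.2), sphEquiv R p.2) := fun p => rfl
    rw [← hT.integral_comp' (g := fun p => g p * ⟪R e, w p⟫ ^ 2)]
    refine integral_congr_ae (Filter.Eventually.of_forall fun p => ?_)
    have h1 : w (T p) = R (w p) := by
      simp only [hw, hTe, hv', sphEquiv_coe, ← map_sub, ← map_add, ← map_smul, R.norm_map]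
    have h2 : g (T p) = g p := by
      simp only [hg, hTe, hb, sphEquiv_coe, ← map_sub, R.norm_map, R.inner_map_map,
        R.injective.eq_iff]
    simp only [h1, h2, R.inner_map_map]
  have hnorm : ∀ e f : E3, ‖e‖ = ‖f‖ →
      ∫ p, g p * ⟪e, w p⟫ ^ 2 ∂μ = ∫ p, g p * ⟪f, w p⟫ ^ 2 ∂μ := by
    intro e f h
    rw [← hinv (Submodule.reflection (ℝ ∙ (e - f))ᗮ) e, Submodule.reflection_sub h]
  have hi : ∀ i : Fin 3, ∫ p, g p * ⟪u, w p⟫ ^ 2 ∂μ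
      = ‖u‖ ^ 2 * ∫ p, g p * ⟪EuclideanSpace.single i (1 : ℝ), w p⟫ ^ 2 ∂μ := by
    intro i
    rw [hnorm u (‖u‖ • EuclideanSpace.single i (1 : ℝ)) (by simp [norm_smul]),
      ← integral_const_mul]
    refine integral_congr_ae (Filter.Eventually.of_forall fun p => ?_)
    simp only [real_inner_smul_left]; ring
  have hs : ∫ p, g p * ‖w p‖ ^ 2 ∂μ
      = ∑ i : Fin 3, ∫ p, g p * ⟪EuclideanSpace.single i (1 : ℝ), w p⟫ ^ 2 ∂μ := by
    rw [← integral_finsetSum _ fun i _ => hI _]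
    refine integral_congr_ae (Filter.Eventually.of_forall fun p => ?_)
    simp only [← Finset.mul_sum, EuclideanSpace.norm_sq_eq, EuclideanSpace.inner_single_left]
    simp
  rw [hs, Fin.sum_univ_three]
  linear_combination (hi 0 + hi 1 + hi 2) / 3
end

section
/- Let ν : ℝ³ → ℝ be continuously differentiable with ν(v) ≥ ν₀ for some ν₀ > 0 and with ∇ν bounded on ℝ³, and set ν̄₄ := sup_{v∈ℝ³} |∇ν(v)|²/(2ν(v)). Then for every smooth compactly supported function f : ℝ³ → ℝ, ∫_{ℝ³} ∇f(v) · ∇(ν f)(v) dv ≥ (1/2) ∫_{ℝ³} |∇f(v)|² ν(v) dv − ν̄₄ ∫_{ℝ³} f(v)² dv. -/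
open MeasureTheory
open scoped RealInnerProductSpace

/-- Hypothesis (H1.2) for the multiplication operator `Λf = νf`: for `ν ∈ C¹` bounded
below by `ν₀ > 0` with bounded gradient, and any smooth compactly supported `f`,
`∫ ∇f · ∇(νf) ≥ (1/2) ∫ |∇f|² ν - ν̄₄ ∫ f²` where `ν̄₄ = sup |∇ν|²/(2ν)`. -/
theorem stmt15 (ν : EuclideanSpace ℝ (Fin 3) → ℝ) (hν : ContDiff ℝ 1 ν)
    (ν₀ : ℝ) (hν₀ : 0 < ν₀) (hlow : ∀ v, ν₀ ≤ ν v)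
    (Mg : ℝ) (hbdd : ∀ v, ‖gradient ν v‖ ≤ Mg)
    (ν₄ : ℝ) (hν₄ : ν₄ = ⨆ v : EuclideanSpace ℝ (Fin 3), ‖gradient ν v‖ ^ 2 / (2 * ν v))
    (f : EuclideanSpace ℝ (Fin 3) → ℝ) (hf : ContDiff ℝ (⊤ : ℕ∞) f)
    (hsupp : HasCompactSupport f) :
    (1 / 2) * (∫ v : EuclideanSpace ℝ (Fin 3), ‖gradient f v‖ ^ 2 * ν v)
        - ν₄ * ∫ v : EuclideanSpace ℝ (Fin 3), f v ^ 2
      ≤ ∫ v : EuclideanSpace ℝ (Fin 3),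
          ⟪gradient f v, gradient (fun w => ν w * f w) v⟫ := by
  have hνd : Differentiable ℝ ν := hν.differentiable one_ne_zero
  have hf1 : ContDiff ℝ 1 f := hf.of_le (by exact_mod_cast le_top)
  have hfd : Differentiable ℝ f := hf1.differentiable one_ne_zero
  have hgrad : ∀ v, gradient (fun w => ν w * f w) v = ν v • gradient f v + f v • gradient ν v := by
    intro v
    unfold gradient
    rw [fderiv_fun_mul (hνd v) (hfd v)]
    simp
  have hcν : Continuous (gradient ν) :=
    (LinearIsometryEquiv.continuous _).comp (hν.continuous_fderiv one_ne_zero)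
  have hcf : Continuous (gradient f) :=
    (LinearIsometryEquiv.continuous _).comp (hf1.continuous_fderiv one_ne_zero)
  have hsg : HasCompactSupport (gradient f) :=
    (hsupp.fderiv (𝕜 := ℝ)).comp_left (map_zero _)
  have hνc := hν.continuous
  have hfc := hf1.continuous
  have i1 : Integrable (fun v => ‖gradient f v‖ ^ 2 * ν v) := by
    refine Continuous.integrable_of_hasCompactSupport (by fun_prop) ?_
    refine hsg.mono ?_
    intro v hv h
    exact hv (by simp [h])
  have i2 : Integrable (fun v => f v ^ 2) := by
    refine Continuous.integrable_of_hasCompactSupport (by fun_prop) ?_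
    refine hsupp.mono ?_
    intro v hv h
    exact hv (by simp [h])
  have i3 : Integrable (fun v => ⟪gradient f v, gradient (fun w => ν w * f w) v⟫) := by
    simp only [hgrad]
    refine Continuous.integrable_of_hasCompactSupport (by fun_prop) ?_
    refine hsg.mono ?_
    intro v hv h
    exact hv (by simp [h])
  have hb : BddAbove (Set.range fun v => ‖gradient ν v‖ ^ 2 / (2 * ν v)) := by
    refine ⟨Mg ^ 2 / (2 * ν₀), ?_⟩
    rintro _ ⟨v, rfl⟩
    have h1 := hbdd v
    have h2 := hlow v
    dsimp only
    gcongr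
  rw [← integral_const_mul, ← integral_const_mul,
    ← integral_sub (i1.const_mul _) (i2.const_mul _)]
  refine integral_mono ((i1.const_mul _).sub (i2.const_mul _)) i3 ?_
  intro v
  have hle : ‖gradient ν v‖ ^ 2 / (2 * ν v) ≤ ν₄ := hν₄ ▸ le_ciSup hb v
  have hp : 0 < ν v := hν₀.trans_le (hlow v)
  have hcs := abs_real_inner_le_norm (gradient f v) (gradient ν v)
  simp only [hgrad, inner_add_right, inner_smul_right, real_inner_self_eq_norm_sq]
  have hm := mul_le_mul_of_nonneg_right hle (sq_nonneg (f v))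
  have h1 : -(|f v| * (‖gradient f v‖ * ‖gradient ν v‖))
      ≤ f v * ⟪gradient f v, gradient ν v⟫ := by
    refine le_trans ?_ (neg_abs_le _)
    rw [abs_mul]
    gcongr
  have h2 : |f v| * (‖gradient f v‖ * ‖gradient ν v‖) ≤
      1 / 2 * (‖gradient f v‖ ^ 2 * ν v) + ‖gradient ν v‖ ^ 2 / (2 * ν v) * f v ^ 2 := by
    rw [← sq_abs (f v)]
    have : 1 / 2 * (‖gradient f v‖ ^ 2 * ν v) + ‖gradient ν v‖ ^ 2 / (2 * ν v) * |f v| ^ 2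
      - |f v| * (‖gradient f v‖ * ‖gradient ν v‖)
      = (‖gradient f v‖ * ν v - |f v| * ‖gradient ν v‖) ^ 2 / (2 * ν v) := by
      field_simp
      ring
    have h3 : 0 ≤ (‖gradient f v‖ * ν v - |f v| * ‖gradient ν v‖) ^ 2 / (2 * ν v) := by
      positivity
    linarith
  linarith
end
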